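/- Let (Ω, μ) be a finite probability space and let ℐ = (Y_1, …, Y_D) be a family of random variables on Ω with nonempty finite codomains. Let S ⊆ S' ⊆ {1,…,D} be nonempty subsets such that H(Y_k) ≤ min_{i∈S} H(Y_i) for every k ∈ S'∖S (i.e., S' is a low-entropy extension of S), and assume W̄(𝒳_S) > 0 and W̄(𝒳_{S'}) > 0. Then w̄(S) ≥ ŵ(S'). -/

import Mathlib

open Real BigOperators
open scoped Classical

/-- The distribution of a random variable `X : Ω → A` under the pmf `μ`. -/
noncomputable def prob {Ω : Type} [Fintype Ω] (μ : Ω → ℝ) {A : Type} [DecidableEq A]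
    (X : Ω → A) (a : A) : ℝ :=
  ∑ ω ∈ Finset.univ.filter (fun ω => X ω = a), μ ω

/-- Shannon entropy (natural logarithm, `0 · log 0 = 0`) of a random variable. -/
noncomputable def entropy {Ω : Type} [Fintype Ω] (μ : Ω → ℝ) {A : Type} [Fintype A]
    [DecidableEq A] (X : Ω → A) : ℝ :=
  -∑ a : A, prob μ X a * Real.log (prob μ X a)

section Subfamily

variable {Ω : Type} [Fintype Ω] {D : ℕ} {A : Fin D → Type}
  [∀ i, Fintype (A i)] [∀ i, DecidableEq (A i)]

/-- Total correlation `W(𝒳_S)` of the subfamily `(Y_i)_{i∈S}`: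
`Σ_{i∈S} H(Y_i) − H((Y_i)_{i∈S})`, where the joint entropy is that of the tuple-valued
random variable `ω ↦ (Y_i ω)_{i∈S}`. -/
noncomputable def subW (μ : Ω → ℝ) (Y : ∀ i, Ω → A i) (S : Finset (Fin D)) : ℝ :=
  (∑ i ∈ S, entropy μ (Y i)) -
    entropy μ (fun ω => (fun i : {x // x ∈ S} => Y i.1 ω))

/-- `W̄(𝒳_S) = Σ_{i∈S} H(Y_i) − max_{i∈S} H(Y_i)`. -/
noncomputable def subWbar (μ : Ω → ℝ) (Y : ∀ i, Ω → A i) (S : Finset (Fin D)) : ℝ :=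
  (∑ i ∈ S, entropy μ (Y i)) - ⨆ i : {x // x ∈ S}, entropy μ (Y i.1)

/-- The (plug-in) normalized total correlation `ŵ(S) = W(𝒳_S)/W̄(𝒳_S)`. -/
noncomputable def what (μ : Ω → ℝ) (Y : ∀ i, Ω → A i) (S : Finset (Fin D)) : ℝ :=
  subW μ Y S / subWbar μ Y S

/-- The refinement elements of `S`:
`R_S = {k ∉ S : H(Y_k) ≤ min_{i∈S} H(Y_i)}`. -/
noncomputable def RS (μ : Ω → ℝ) (Y : ∀ i, Ω → A i) (S : Finset (Fin D)) :
    Finset (Fin D) :=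
  Finset.univ.filter (fun k => k ∉ S ∧ ∀ i ∈ S, entropy μ (Y k) ≤ entropy μ (Y i))

/-- The bound `w̄(S) = (W(𝒳_S) + Σ_{k∈R_S} H(Y_k)) / (W̄(𝒳_S) + Σ_{k∈R_S} H(Y_k))`. -/
noncomputable def wbarRef (μ : Ω → ℝ) (Y : ∀ i, Ω → A i) (S : Finset (Fin D)) : ℝ :=
  (subW μ Y S + ∑ k ∈ RS μ Y S, entropy μ (Y k)) /
    (subWbar μ Y S + ∑ k ∈ RS μ Y S, entropy μ (Y k))

end Subfamily

section Entropy

variable {Ω : Type} [Fintype Ω] {μ : Ω → ℝ} {A B : Type} [DecidableEq A] [DecidableEq B]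

theorem entropy_eq_neg_sum_mul_log [Fintype A] (μ : Ω → ℝ) (X : Ω → A) :
    entropy μ X = -∑ ω, μ ω * Real.log (prob μ X (X ω)) := by
  unfold entropy
  rw [← Finset.sum_fiberwise Finset.univ X]
  refine congrArg _ (Finset.sum_congr rfl fun a _ => ?_)
  conv_lhs => rw [prob, Finset.sum_mul]
  refine Finset.sum_congr rfl fun ω hω => ?_
  rw [(Finset.mem_filter.1 hω).2]
  rfl

theorem le_prob_apply (hμ0 : ∀ ω, 0 ≤ μ ω) (X : Ω → A) (ω : Ω) : μ ω ≤ prob μ X (X ω) :=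
  Finset.single_le_sum (f := μ) (fun _ _ => hμ0 _) (by simp)

theorem prob_apply_mono (hμ0 : ∀ ω, 0 ≤ μ ω) {X : Ω → A} {Z : Ω → B}
    (h : ∀ ω ω', X ω = X ω' → Z ω = Z ω') (ω : Ω) :
    prob μ X (X ω) ≤ prob μ Z (Z ω) := by
  refine Finset.sum_le_sum_of_subset_of_nonneg (fun ω' hω' => ?_) fun _ _ _ => hμ0 _
  simp only [Finset.mem_filter, Finset.mem_univ, true_and] at hω' ⊢
  exact h _ _ hω'

/-- A random variable determined by another one has at most its entropy. -/
theorem entropy_le_of_determined [Fintype A] [Fintype B] (hμ0 : ∀ ω, 0 ≤ μ ω)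
    {X : Ω → A} {Z : Ω → B} (h : ∀ ω ω', X ω = X ω' → Z ω = Z ω') :
    entropy μ Z ≤ entropy μ X := by
  rw [entropy_eq_neg_sum_mul_log, entropy_eq_neg_sum_mul_log]
  refine neg_le_neg (Finset.sum_le_sum fun ω _ => ?_)
  rcases (hμ0 ω).eq_or_lt with h0 | hpos
  · simp [← h0]
  · exact mul_le_mul_of_nonneg_left
      (Real.log_le_log (hpos.trans_le (le_prob_apply hμ0 X ω)) (prob_apply_mono hμ0 h ω)) hpos.le

theorem entropy_nonneg [Fintype A] (hμ0 : ∀ ω, 0 ≤ μ ω) (hμ1 : ∑ ω, μ ω = 1) (X : Ω → A) :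
    0 ≤ entropy μ X := by
  have hconst : entropy μ (fun _ : Ω => ()) = 0 := by simp [entropy, prob, hμ1]
  exact hconst ▸ entropy_le_of_determined hμ0 fun _ _ _ => rfl

end Entropy

section Extension

variable {Ω : Type} [Fintype Ω] {μ : Ω → ℝ} {D : ℕ} {A : Fin D → Type}
  [∀ i, Fintype (A i)] [∀ i, DecidableEq (A i)] {Y : ∀ i, Ω → A i} {S S' : Finset (Fin D)}

theorem subW_le_subWbar (hμ0 : ∀ ω, 0 ≤ μ ω) (hS : S.Nonempty) :
    subW μ Y S ≤ subWbar μ Y S := by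
  have : Nonempty {x // x ∈ S} := hS.to_subtype
  exact sub_le_sub_left
    (ciSup_le fun i => entropy_le_of_determined hμ0 fun _ _ h => congrFun h i) _

theorem subW_le_of_subset (hμ0 : ∀ ω, 0 ≤ μ ω) (hSS' : S ⊆ S') :
    subW μ Y S' ≤ subW μ Y S + ∑ k ∈ S' \ S, entropy μ (Y k) := by
  have hsum := Finset.sum_sdiff (f := fun k => entropy μ (Y k)) hSS'
  have hjoint : entropy μ (fun ω => (fun i : {x // x ∈ S} => Y i.1 ω)) ≤
      entropy μ (fun ω => (fun i : {x // x ∈ S'} => Y i.1 ω)) :=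
    entropy_le_of_determined hμ0 fun _ _ h => funext fun i => congrFun h ⟨i.1, hSS' i.2⟩
  unfold subW
  linarith

theorem subWbar_eq_of_low_entropy_extension (hS : S.Nonempty) (hSS' : S ⊆ S')
    (hlow : ∀ k ∈ S' \ S, ∀ i ∈ S, entropy μ (Y k) ≤ entropy μ (Y i)) :
    subWbar μ Y S' = subWbar μ Y S + ∑ k ∈ S' \ S, entropy μ (Y k) := by
  have hsum := Finset.sum_sdiff (f := fun k => entropy μ (Y k)) hSS'
  have hmax : (⨆ i : {x // x ∈ S'}, entropy μ (Y i.1)) =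
      ⨆ i : {x // x ∈ S}, entropy μ (Y i.1) := by
    have : Nonempty {x // x ∈ S} := hS.to_subtype
    have : Nonempty {x // x ∈ S'} := (hS.mono hSS').to_subtype
    have hle (i : {x // x ∈ S}) : entropy μ (Y i.1) ≤ ⨆ i : {x // x ∈ S}, entropy μ (Y i.1) :=
      le_ciSup (f := fun i : {x // x ∈ S} => entropy μ (Y i.1)) (Set.finite_range _).bddAbove i
    refine le_antisymm (ciSup_le fun k => ?_) (ciSup_le fun i => ?_)
    · by_cases hk : k.1 ∈ S
      · exact hle ⟨k.1, hk⟩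
      · obtain ⟨i, hi⟩ := hS
        exact (hlow k.1 (Finset.mem_sdiff.2 ⟨k.2, hk⟩) i hi).trans (hle ⟨i, hi⟩)
    · exact le_ciSup (f := fun i : {x // x ∈ S'} => entropy μ (Y i.1))
        (Set.finite_range _).bddAbove ⟨i.1, hSS' i.2⟩
  unfold subWbar
  linarith

end Extension

/-- Let `ℐ = (Y_1, …, Y_D)` be random variables on a finite probability
space and `S ⊆ S'` nonempty index sets such that `S'` is a low-entropy extension of `S`
(`H(Y_k) ≤ min_{i∈S} H(Y_i)` for all `k ∈ S'∖S`), with `W̄(𝒳_S) > 0` and `W̄(𝒳_{S'}) > 0`.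
Then `w̄(S) ≥ ŵ(S')`. -/
theorem wbarRef_ge_what_of_low_entropy_extension {Ω : Type} [Fintype Ω] [Nonempty Ω]
    (μ : Ω → ℝ) (hμ0 : ∀ ω, 0 ≤ μ ω) (hμ1 : ∑ ω, μ ω = 1)
    {D : ℕ} {A : Fin D → Type}
    [∀ i, Fintype (A i)] [∀ i, DecidableEq (A i)] [∀ i, Nonempty (A i)]
    (Y : ∀ i, Ω → A i) (S S' : Finset (Fin D))
    (hS : S.Nonempty) (hS' : S'.Nonempty) (hSS' : S ⊆ S')
    (hlow : ∀ k ∈ S' \ S, ∀ i ∈ S, entropy μ (Y k) ≤ entropy μ (Y i))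
    (hWS : 0 < subWbar μ Y S) (hWS' : 0 < subWbar μ Y S') :
    wbarRef μ Y S ≥ what μ Y S' := by
  have hsub : S' \ S ⊆ RS μ Y S := fun k hk =>
    Finset.mem_filter.2 ⟨Finset.mem_univ k, (Finset.mem_sdiff.1 hk).2, hlow k hk⟩
  have hsum : ∑ k ∈ S' \ S, entropy μ (Y k) ≤ ∑ k ∈ RS μ Y S, entropy μ (Y k) :=
    Finset.sum_le_sum_of_subset_of_nonneg hsub fun k _ _ => entropy_nonneg hμ0 hμ1 (Y k)
  have hnonneg : 0 ≤ ∑ k ∈ S' \ S, entropy μ (Y k) :=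
    Finset.sum_nonneg fun k _ => entropy_nonneg hμ0 hμ1 (Y k)
  have hW := subW_le_of_subset (Y := Y) hμ0 hSS'
  have hle := subW_le_subWbar (Y := Y) hμ0 hS
  have hWbar := subWbar_eq_of_low_entropy_extension hS hSS' hlow
  unfold wbarRef what
  rw [ge_iff_le, div_le_div_iff₀ hWS' (by linarith), hWbar]
  rw [hWbar] at hWS'
  refine (mul_le_mul_of_nonneg_right hW (by linarith)).trans ?_
  linarith [mul_nonneg (sub_nonneg.2 hle) (sub_nonneg.2 hsum)]
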